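/- Let $G$ be a $k$-connected graph and let $A$ and $B$ be two subsets of its vertices, each of cardinality at least $k$. Then there exist $k$ pairwise vertex-disjoint paths in $G$, each with first vertex in $A$, last vertex in $B$, and no other vertex in $A \cup B$. -/

import Mathlib

open SimpleGraph

/-- A graph is `k`-connected if it has more than `k` vertices and removing any set of
fewer than `k` vertices leaves it connected. -/
def KConnected {V : Type*} (G : SimpleGraph V) (k : ℕ) : Prop :=
  k < Nat.card V ∧ ∀ S : Finset V, S.card < k → (G.induce ((↑S : Set V)ᶜ)).Connected

namespace MengerAux

variable {V : Type*}

/-- `b` is reachable from `a` along `r` inside `X`. -/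
def Rch (r : V → V → Prop) (X : Set V) (a b : V) : Prop :=
  a ∈ X ∧ Relation.ReflTransGen (fun u v => r u v ∧ u ∈ X ∧ v ∈ X) a b

theorem Rch.refl {r : V → V → Prop} {X : Set V} {a : V} (h : a ∈ X) : Rch r X a a :=
  ⟨h, .refl⟩

theorem Rch.right {r : V → V → Prop} {X : Set V} {a b : V} (h : Rch r X a b) : b ∈ X := by
  obtain ⟨h1, h2⟩ := h
  induction h2 with
  | refl => exact h1
  | tail _ h _ => exact h.2.2

theorem Rch.step {r : V → V → Prop} {X : Set V} {a b c : V} (h : Rch r X a b)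
    (h' : r b c) (hc : c ∈ X) : Rch r X a c :=
  ⟨h.1, h.2.tail ⟨h', h.right, hc⟩⟩

theorem Rch.ind {r : V → V → Prop} {X : Set V} {a b : V} (h : Rch r X a b)
    (P : V → Prop) (h0 : P a)
    (hs : ∀ u v, Rch r X a u → P u → r u v → v ∈ X → P v) : P b := by
  obtain ⟨h1, h2⟩ := h
  induction h2 with
  | refl => exact h0
  | tail hh h ih => exact hs _ _ ⟨h1, hh⟩ ih h.1 h.2.2

theorem Rch.trans {r : V → V → Prop} {X : Set V} {a b c : V} (h : Rch r X a b)
    (h' : Rch r X b c) : Rch r X a c := ⟨h.1, h.2.trans h'.2⟩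

theorem Rch.mono {r r' : V → V → Prop} {X X' : Set V} {a b : V} (h : Rch r X a b)
    (hr : ∀ u v, r u v → r' u v) (hX : X ⊆ X') : Rch r' X' a b :=
  h.ind (fun u => Rch r' X' a u) (.refl (hX h.1))
    (fun _ _ _ h1 h2 h3 => h1.step (hr _ _ h2) (hX h3))

theorem Rch.swap {r : V → V → Prop} {X : Set V} {a b : V} (h : Rch r X a b) :
    Rch (fun u v => r v u) X b a := by
  refine ⟨h.right, ?_⟩
  have := h.2.swap
  refine Relation.ReflTransGen.mono ?_ _ _ this
  rintro u v ⟨h1, h2, h3⟩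
  exact ⟨h1, h3, h2⟩

/-- `T` separates `A` from `B`. -/
def Sep (r : V → V → Prop) (A B : Set V) (T : Finset V) : Prop :=
  ∀ a ∈ A, ∀ b ∈ B, ¬ Rch r (↑T)ᶜ a b

theorem Sep.swap {r : V → V → Prop} {A B : Set V} {T : Finset V} (h : Sep r A B T) :
    Sep (fun u v => r v u) B A T := fun b hb a ha hr => h a ha b hb hr.swap

/-- `k` disjoint connections from `A` to `B`. -/
def Link (r : V → V → Prop) (A B : Set V) (k : ℕ) : Prop :=
  ∃ (a b : Fin k → V) (X : Fin k → Set V), (∀ i, a i ∈ A) ∧ (∀ i, b i ∈ B) ∧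
    (∀ i, Rch r (X i) (a i) (b i)) ∧ ∀ i j v, v ∈ X i → v ∈ X j → i = j

theorem Link.swap {r : V → V → Prop} {A B : Set V} {k : ℕ} (h : Link r A B k) :
    Link (fun u v => r v u) B A k := by
  obtain ⟨a, b, X, h1, h2, h3, h4⟩ := h
  exact ⟨b, a, X, h2, h1, fun i => (h3 i).swap, h4⟩

theorem sep_insert [DecidableEq V] {r r' : V → V → Prop} {x y : V}
    (hr : ∀ u v, r u v → ¬ (u = x ∧ v = y) → r' u v) {A B : Set V} {S : Finset V}
    (hS : Sep r' A B S) : Sep r A B (insert x S) := by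
  intro a ha b hb h
  apply hS a ha b hb
  refine h.ind (fun u => Rch r' (↑S)ᶜ a u) (.refl ?_) ?_
  · have := h.1
    simp at this ⊢
    tauto
  · intro u v h1 h2 h3 h4
    refine h2.step (hr _ _ h3 ?_) ?_
    · rintro ⟨rfl, -⟩
      have := h1.right
      simp at this
    · simp at h4 ⊢
      tauto

theorem sep_half [DecidableEq V] {r r' : V → V → Prop} {x y : V}
    (hr : ∀ u v, r u v → ¬ (u = x ∧ v = y) → r' u v) {A B : Set V} {S T : Finset V}
    (hS : Sep r' A B S) (hT : Sep r' A (↑(insert x S) : Set V) T) : Sep r A B T := by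
  intro a ha b hb h
  have key : ∀ u, Rch r' (↑T)ᶜ a u → u ≠ x ∧ u ∉ S := by
    intro u hu
    by_contra hc
    refine hT a ha u ?_ hu
    simp
    tauto
  have := h.ind (fun u => Rch r' (↑T)ᶜ a u ∧ Rch r' (↑S)ᶜ a u)
    ⟨.refl h.1, .refl (by simpa using (key a (.refl h.1)).2)⟩ ?_
  · exact hS a ha b hb this.2
  · rintro u v - ⟨h1, h2⟩ h3 h4
    have e : r' u v := hr _ _ h3 (fun hh => (key u h1).1 hh.1)
    have h5 := h1.step e h4
    exact ⟨h5, h2.step e (by simpa using (key v h5).2)⟩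

/-- One half of the construction. -/
theorem half [DecidableEq V] {r r' : V → V → Prop} {x y : V} {k : ℕ}
    (hr : ∀ u v, r u v → ¬ (u = x ∧ v = y) → r' u v) {A B : Set V} {S : Finset V}
    (hS : Sep r' A B S) (hmin : ∀ T, Sep r A B T → k ≤ T.card) (hk : S.card < k)
    (IH : ∀ A B : Set V, (∀ T, Sep r' A B T → k ≤ T.card) → Link r' A B k) :
    x ∉ S ∧ ∃ (a b : Fin k → V) (X : Fin k → Set V), (∀ i, a i ∈ A) ∧
      (∀ i, b i ∈ insert x S) ∧ Function.Injective b ∧ (∀ s ∈ insert x S, ∃ i, b i = s) ∧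
      (∀ i, Rch r' (X i) (a i) (b i)) ∧ (∀ i j v, v ∈ X i → v ∈ X j → i = j) ∧
      (∀ i, ∀ v ∈ X i, v ∈ S → v = b i) ∧
      ∀ i, ∀ v ∈ X i, v ∉ S → ∃ a ∈ A, Rch r' (↑S)ᶜ a v := by
  have hc := hmin _ (sep_insert hr hS)
  have hxS : x ∉ S := by
    intro h
    rw [Finset.insert_eq_of_mem h] at hc
    omega
  have hcard : (insert x S).card = k := by
    rw [Finset.card_insert_of_notMem hxS] at hc ⊢
    omega
  refine ⟨hxS, ?_⟩
  obtain ⟨a, b, X, ha, hb, hX, hd⟩ := IH A (↑(insert x S) : Set V)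
    (fun T hT => hmin T (sep_half hr hS hT))
  have hb' : ∀ i, b i ∈ insert x S := fun i => by exact_mod_cast hb i
  have hinj : Function.Injective b := by
    intro i j hij
    exact hd i j (b i) (hX i).right (hij ▸ (hX j).right)
  have hsurj : ∀ s ∈ insert x S, ∃ i, b i = s := by
    have : Finset.univ.image b = insert x S := by
      apply Finset.eq_of_subset_of_card_le
      · intro v hv
        obtain ⟨i, -, rfl⟩ := Finset.mem_image.1 hv
        exact hb' i
      · rw [Finset.card_image_of_injective _ hinj, hcard]
        simp
    intro s hs
    rw [← this] at hs
    obtain ⟨i, -, h⟩ := Finset.mem_image.1 hs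
    exact ⟨i, h⟩
  have hend : ∀ i, ∀ v ∈ X i, v ∈ S → v = b i := by
    intro i v hv hvS
    obtain ⟨j, rfl⟩ := hsurj v (Finset.mem_insert_of_mem hvS)
    rw [hd i j _ hv (hX j).right]
  refine ⟨a, b, fun i => {v | v ∈ X i ∧ (v ∉ S → ∃ a ∈ A, Rch r' (↑S)ᶜ a v)}, ha, hb', hinj,
    hsurj, ?_, fun i j v h1 h2 => hd i j v h1.1 h2.1, fun i v hv => hend i v hv.1,
    fun i v hv => hv.2⟩
  intro i
  set Y : Set V := {v | v ∈ X i ∧ (v ∉ S → ∃ a ∈ A, Rch r' (↑S)ᶜ a v)} with hY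
  have := (hX i).ind (fun u => (Rch r' Y (a i) u ∧ u ∉ S) ∨ Rch r' Y (a i) (b i)) ?_ ?_
  · rcases this with h | h
    · exact h.1
    · exact h
  · have haY : a i ∈ Y := ⟨(hX i).1, fun h => ⟨a i, ha i, .refl (by simpa using h)⟩⟩
    by_cases h : a i ∈ S
    · right
      rw [← hend i _ (hX i).1 h]
      exact .refl haY
    · exact .inl ⟨.refl haY, h⟩
  · rintro u v - (⟨h1, h2⟩ | h1) h3 h4
    · by_cases h : v ∈ S
      · right
        rw [← hend i _ h4 h]
        exact h1.step h3 ⟨h4, fun h' => absurd h h'⟩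
      · left
        refine ⟨h1.step h3 ⟨h4, fun _ => ?_⟩, h⟩
        obtain ⟨a', ha', h5⟩ := h1.right.2 h2
        exact ⟨a', ha', h5.step h3 (by simpa using h)⟩
    · exact .inr h1

theorem menger [Finite V] (n : ℕ) : ∀ (r : V → V → Prop), {p : V × V | r p.1 p.2}.ncard = n →
    ∀ (k : ℕ) (A B : Set V), (∀ T, Sep r A B T → k ≤ T.card) → Link r A B k := by
  classical
  induction n using Nat.strong_induction_on with
  | _ n ih =>
  intro r hn k A B hmin
  by_cases he : ∃ x y, r x y
  · obtain ⟨x, y, hxy⟩ := he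
    obtain ⟨r', hr'⟩ : ∃ r' : V → V → Prop, ∀ u v, r' u v ↔ r u v ∧ ¬ (u = x ∧ v = y) :=
      ⟨_, fun _ _ => Iff.rfl⟩
    have hlt : {p : V × V | r' p.1 p.2}.ncard < n := by
      rw [← hn]
      apply Set.ncard_lt_ncard _ (Set.toFinite _)
      refine ⟨fun p hp => ((hr' _ _).1 hp).1, fun h => ?_⟩
      have := (hr' _ _).1 (h (show (x, y) ∈ {p : V × V | r p.1 p.2} from hxy))
      simp at this
    have IH := ih _ hlt r' rfl k
    have hle : ∀ u v, r' u v → r u v := fun u v h => ((hr' u v).1 h).1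
    by_cases hs : ∀ T, Sep r' A B T → k ≤ T.card
    · obtain ⟨a, b, X, h1, h2, h3, h4⟩ := IH A B hs
      exact ⟨a, b, X, h1, h2, fun i => (h3 i).mono hle subset_rfl, h4⟩
    push Not at hs
    obtain ⟨S, hS, hk⟩ := hs
    obtain ⟨hxS, a, b, X, ha, hb, hbi, hbs, hX, hXd, hXS, hXR⟩ :=
      half (fun u v h1 h2 => (hr' u v).2 ⟨h1, h2⟩) hS hmin hk IH
    obtain ⟨hyS, d, c, Y, hd, hc, hci, hcs, hY, hYd, hYS, hYR⟩ :=
      half (r := fun u v => r v u) (r' := fun u v => r' v u) (x := y) (y := x) (k := k)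
        (fun u v h1 h2 => (hr' v u).2 ⟨h1, fun h => h2 ⟨h.2, h.1⟩⟩) hS.swap
        (fun T hT => hmin T hT.swap) hk
        (fun A B h => (IH B A (fun T hT => h T hT.swap)).swap)
    have hσ : ∀ i, ∃ j, (b i = x ∧ c j = y) ∨ (b i ∈ S ∧ c j = b i) := by
      intro i
      rcases Finset.mem_insert.1 (hb i) with h | h
      · obtain ⟨j, hj⟩ := hcs y (Finset.mem_insert_self _ _)
        exact ⟨j, .inl ⟨h, hj⟩⟩
      · obtain ⟨j, hj⟩ := hcs (b i) (Finset.mem_insert_of_mem h)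
        exact ⟨j, .inr ⟨h, hj⟩⟩
    choose σ hσ using hσ
    have hσi : ∀ i j, σ i = σ j → i = j := by
      intro i j hij
      apply hbi
      have h1 := hσ i
      have h2 := hσ j
      rw [← hij] at h2
      rcases h1 with ⟨h1, h1'⟩ | ⟨h1, h1'⟩ <;> rcases h2 with ⟨h2, h2'⟩ | ⟨h2, h2'⟩
      · rw [h1, h2]
      · rw [← h2', h1'] at h2
        exact absurd h2 hyS
      · rw [← h1', h2'] at h1
        exact absurd h1 hyS
      · rw [← h1', ← h2']
    have hcross : ∀ i j v, v ∈ X i → v ∈ Y (σ j) → i = j := by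
      intro i j v h1 h2
      by_cases hv : v ∈ S
      · have e1 := hXS i v h1 hv
        have e2 := hYS _ v h2 hv
        rcases hσ j with ⟨h3, h4⟩ | ⟨h3, h4⟩
        · rw [e2, h4] at hv
          exact absurd hv hyS
        · apply hbi
          rw [← e1, e2, h4]
      · obtain ⟨a', ha', p⟩ := hXR i v h1 hv
        obtain ⟨b', hb', q⟩ := hYR _ v h2 hv
        exact absurd (p.trans q.swap) (hS a' ha' b' hb')
    refine ⟨a, fun i => d (σ i), fun i => X i ∪ Y (σ i), ha, fun i => hd _, ?_, ?_⟩
    · intro i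
      have p : Rch r (X i ∪ Y (σ i)) (a i) (b i) := (hX i).mono hle Set.subset_union_left
      have q : Rch r (X i ∪ Y (σ i)) (c (σ i)) (d (σ i)) :=
        (hY (σ i)).swap.mono hle Set.subset_union_right
      rcases hσ i with ⟨h3, h4⟩ | ⟨h3, h4⟩
      · exact (p.step (by rw [h3, h4]; exact hxy) q.1).trans q
      · rw [h4] at q
        exact p.trans q
    · rintro i j v (h1 | h1) (h2 | h2)
      · exact hXd _ _ _ h1 h2
      · exact hcross _ _ _ h1 h2
      · exact (hcross _ _ _ h2 h1).symm
      · exact hσi _ _ (hYd _ _ _ h1 h2)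
  · push Not at he
    have hfin : (A ∩ B).Finite := Set.toFinite _
    have hk : k ≤ hfin.toFinset.card := by
      apply hmin
      intro a ha b hb h
      have : b = a := h.ind (fun u => u = a) rfl (fun u v _ _ h _ => absurd h (he u v))
      subst this
      have := h.1
      simp at this
      exact this ha hb
    have f := (hfin.toFinset.equivFin).symm
    let g : Fin k → V := fun i => (f (Fin.castLE hk i) : V)
    have hg : ∀ i, g i ∈ A ∩ B := fun i => by
      exact hfin.mem_toFinset.1 (f (Fin.castLE hk i)).2
    refine ⟨g, g, fun i => {g i}, fun i => (hg i).1, fun i => (hg i).2,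
      fun i => .refl rfl, ?_⟩
    rintro i j v h1 h2
    have : g i = g j := by
      rw [← Set.mem_singleton_iff.1 h1, ← Set.mem_singleton_iff.1 h2]
    exact Fin.castLE_injective hk (f.injective (Subtype.ext this))

theorem exists_walk {G : SimpleGraph V} {X : Set V} {a b : V} (h : Rch G.Adj X a b) :
    ∃ p : G.Walk a b, ∀ v ∈ p.support, v ∈ X := by
  refine h.ind (fun u => ∃ p : G.Walk a u, ∀ v ∈ p.support, v ∈ X)
    ⟨.nil, by simpa using h.1⟩ ?_
  rintro u v - ⟨p, hp⟩ h1 h2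
  refine ⟨p.concat h1, fun w hw => ?_⟩
  rw [Walk.support_concat] at hw
  simp at hw
  rcases hw with hw | rfl
  · exact hp _ hw
  · exact h2

theorem exists_path {G : SimpleGraph V} {X A B : Set V} {a b : V} (ha : a ∈ A) (hb : b ∈ B)
    (h : Rch G.Adj X a b) :
    ∃ (a b : V) (p : G.Walk a b), p.IsPath ∧ a ∈ A ∧ b ∈ B ∧
      (∀ v ∈ p.support, v ∈ A ∪ B → v = a ∨ v = b) ∧ ∀ v ∈ p.support, v ∈ X := by
  classical
  have hex : ∃ n : ℕ, ∃ (a b : V) (p : G.Walk a b), a ∈ A ∧ b ∈ B ∧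
      (∀ v ∈ p.support, v ∈ X) ∧ p.length = n := by
    obtain ⟨p, hp⟩ := exists_walk h
    exact ⟨_, a, b, p, ha, hb, hp, rfl⟩
  obtain ⟨a, b, p, ha, hb, hp, hl⟩ := Nat.find_spec hex
  have hmin : ∀ (a b : V) (q : G.Walk a b), a ∈ A → b ∈ B → (∀ v ∈ q.support, v ∈ X) →
      p.length ≤ q.length := by
    intro a b q h1 h2 h3
    rw [hl]
    exact Nat.find_min' hex ⟨a, b, q, h1, h2, h3, rfl⟩
  have hsub := p.support_bypass_subset_support
  have hlen := p.length_bypass_le_length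
  have hpath := p.bypass_isPath
  refine ⟨a, b, p.bypass, hpath, ha, hb, ?_, fun v hv => hp v (hsub hv)⟩
  intro v hv hAB
  have hspec := congrArg Walk.length (p.bypass.take_spec hv)
  rw [Walk.length_append] at hspec
  rcases hAB with h | h
  · left
    have := hmin v b (p.bypass.dropUntil v hv) h hb
      (fun w hw => hp w (hsub (p.bypass.support_dropUntil_subset_support hv hw)))
    exact (Walk.eq_of_length_eq_zero (p := p.bypass.takeUntil v hv) (by omega)).symm
  · right
    have := hmin a v (p.bypass.takeUntil v hv) ha h
      (fun w hw => hp w (hsub (p.bypass.support_takeUntil_subset_support hv hw)))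
    exact Walk.eq_of_length_eq_zero (p := p.bypass.dropUntil v hv) (by omega)

end MengerAux

open MengerAux

theorem stmt_0 {V : Type*} (G : SimpleGraph V) (k : ℕ)
    (hG : KConnected G k) (A B : Set V)
    (hA : ∃ A₀ : Finset V, ↑A₀ ⊆ A ∧ k ≤ A₀.card)
    (hB : ∃ B₀ : Finset V, ↑B₀ ⊆ B ∧ k ≤ B₀.card) :
    ∃ (a b : Fin k → V) (P : ∀ i, G.Walk (a i) (b i)),
      (∀ i, (P i).IsPath) ∧
      (∀ i, a i ∈ A) ∧ (∀ i, b i ∈ B) ∧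
      (∀ i, ∀ v ∈ (P i).support, v ∈ A ∪ B → v = a i ∨ v = b i) ∧
      (∀ i j, i ≠ j → List.Disjoint (P i).support (P j).support) := by
  obtain ⟨hcard, hconn⟩ := hG
  have : Finite V := Nat.finite_of_card_ne_zero (by omega)
  have hL : Link G.Adj A B k := by
    refine menger _ G.Adj rfl k A B ?_
    intro T hT
    by_contra hlt
    push Not at hlt
    obtain ⟨A₀, hA1, hA2⟩ := hA
    obtain ⟨B₀, hB1, hB2⟩ := hB
    obtain ⟨a, ha, haT⟩ := Finset.exists_mem_notMem_of_card_lt_card (hlt.trans_le hA2)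
    obtain ⟨b, hb, hbT⟩ := Finset.exists_mem_notMem_of_card_lt_card (hlt.trans_le hB2)
    refine hT a (hA1 ha) b (hB1 hb) ?_
    obtain ⟨w⟩ := (hconn T hlt).preconnected ⟨a, by simpa using haT⟩ ⟨b, by simpa using hbT⟩
    have key : ∀ (u v : ((↑T : Set V)ᶜ : Set V)) (w : (G.induce ((↑T : Set V)ᶜ)).Walk u v),
        Rch G.Adj (↑T)ᶜ u.1 v.1 := by
      intro u v w
      induction w with
      | nil => exact .refl (Subtype.prop _)
      | cons h _ ih => exact ((Rch.refl (Subtype.prop _)).step h (Subtype.prop _)).trans ih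
    exact key _ _ w
  obtain ⟨a, b, X, ha, hb, hX, hd⟩ := hL
  choose a' b' P h1 h2 h3 h4 h5 using fun i => exists_path (ha i) (hb i) (hX i)
  exact ⟨a', b', P, h1, h2, h3, h4, fun i j hij v hv hv' =>
    hij (hd i j v (h5 i v hv) (h5 j v hv'))⟩
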